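/- Let λ > 0. Then G_λ is the fundamental solution of −Δ + λ in ℝ³: for every smooth compactly supported φ : ℝ³ → ℂ, ∫_{ℝ³} G_λ(x) (−Δφ(x) + λ φ(x)) dx = φ(0), i.e., (−Δ + λ) G_λ = δ in the sense of distributions. -/

import Mathlib

open MeasureTheory Real Filter Topology

noncomputable section

/-- The Green function `G_λ(x) = e^{-√λ ‖x‖}/(4π‖x‖)` of `-Δ + λ` in three dimensions. -/
def greenFn (lam : ℝ) (x : EuclideanSpace ℝ (Fin 3)) : ℝ :=
  Real.exp (-Real.sqrt lam * ‖x‖) / (4 * π * ‖x‖)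

/-- The Laplacian of a function on `ℝ³`, as the trace of its second derivative. -/
def lap3 (φ : EuclideanSpace ℝ (Fin 3) → ℂ) (x : EuclideanSpace ℝ (Fin 3)) : ℂ :=
  ∑ i : Fin 3, iteratedFDeriv ℝ 2 φ x ![EuclideanSpace.single i 1, EuclideanSpace.single i 1]

abbrev E3 := EuclideanSpace ℝ (Fin 3)

def rho (ε : ℝ) (x : E3) : ℝ := √(‖x‖ ^ 2 + ε ^ 2)

def gE (k s : ℝ) : ℝ := Real.exp (-k * s) / (4 * π * s)
def hE (k s : ℝ) : ℝ := -(k / s ^ 2 + 1 / s ^ 3) * Real.exp (-k * s) / (4 * π)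
def h2E (k s : ℝ) : ℝ := (k ^ 2 / s ^ 3 + 3 * k / s ^ 4 + 3 / s ^ 5) * Real.exp (-k * s) / (4 * π)

lemma rho_pos {ε : ℝ} (hε : 0 < ε) (x : E3) : 0 < rho ε x := by
  unfold rho; positivity

lemma rho_sq (ε : ℝ) (x : E3) : rho ε x ^ 2 = ‖x‖ ^ 2 + ε ^ 2 :=
  Real.sq_sqrt (by positivity)

lemma rho_cont (ε : ℝ) : Continuous (rho ε) := by unfold rho; fun_prop

lemma gE_cont {k ε : ℝ} (hε : 0 < ε) : Continuous (fun x => gE k (rho ε x)) := by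
  have := rho_cont ε
  unfold gE
  refine Continuous.div (by fun_prop) (by fun_prop) fun x => ?_
  have := rho_pos hε x
  positivity

lemma hE_cont {k ε : ℝ} (hε : 0 < ε) : Continuous (fun x => hE k (rho ε x)) := by
  have := rho_cont ε
  have h (x) := (rho_pos hε x).ne'
  unfold hE
  fun_prop (disch := simp [h])

lemma h2E_cont {k ε : ℝ} (hε : 0 < ε) : Continuous (fun x => h2E k (rho ε x)) := by
  have := rho_cont ε
  have h (x) := (rho_pos hε x).ne'
  unfold h2E
  fun_prop (disch := simp [h])

lemma rho_line {ε : ℝ} (hε : 0 < ε) (x : E3) (i : Fin 3) :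
    HasDerivAt (fun t : ℝ => rho ε (x + t • EuclideanSpace.single i (1 : ℝ))) (x i / rho ε x) 0 := by
  have h0 : HasFDerivAt (fun y : E3 => ‖y‖ ^ 2 + ε ^ 2) (2 • innerSL ℝ x) x :=
    (hasStrictFDerivAt_norm_sq x).hasFDerivAt.add_const _
  have h1 := (h0.hasLineDerivAt (EuclideanSpace.single i (1 : ℝ)))
  have h2 : HasDerivAt (fun t : ℝ => ‖x + t • EuclideanSpace.single i (1 : ℝ)‖ ^ 2 + ε ^ 2) _ 0 := h1
  have h3 := h2.sqrt (by simp; positivity)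
  unfold rho
  convert h3 using 1
  simp [EuclideanSpace.inner_single_right]
  field_simp

lemma gE_deriv {k s : ℝ} (hs : 0 < s) : HasDerivAt (gE k) (s * hE k s) s := by
  have h1 : HasDerivAt (fun s : ℝ => Real.exp (-k * s)) _ s :=
    ((hasDerivAt_id s).const_mul (-k)).exp
  have h2 : HasDerivAt (fun s : ℝ => 4 * π * s) _ s := (hasDerivAt_id s).const_mul (4 * π)
  have := h1.div h2 (by positivity)
  refine HasDerivAt.congr_deriv this ?_
  unfold hE
  simp
  field_simp
  ring

lemma hE_deriv {k s : ℝ} (hs : 0 < s) : HasDerivAt (hE k) (s * h2E k s) s := by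
  have h1 : HasDerivAt (fun s : ℝ => Real.exp (-k * s)) _ s :=
    ((hasDerivAt_id s).const_mul (-k)).exp
  have h2 : HasDerivAt (fun s : ℝ => k / s ^ 2 ) _ s :=
    (hasDerivAt_const s k).div (hasDerivAt_pow 2 s) (by positivity)
  have h3 : HasDerivAt (fun s : ℝ => 1 / s ^ 3 ) _ s :=
    (hasDerivAt_const s 1).div (hasDerivAt_pow 3 s) (by positivity)
  have := ((h2.add h3).neg.mul h1).div_const (4 * π)
  refine HasDerivAt.congr_deriv this ?_
  unfold h2E
  simp
  field_simp
  ring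

lemma G_line {k ε : ℝ} (hε : 0 < ε) (x : E3) (i : Fin 3) :
    HasLineDerivAt ℝ (fun x => gE k (rho ε x)) (hE k (rho ε x) * x i) x
      (EuclideanSpace.single i (1 : ℝ)) := by
  have hp := rho_pos hε x
  have h := (gE_deriv (k := k) hp)
  have h2 := rho_line hε x i
  have h3 : HasDerivAt (gE k) (rho ε x * hE k (rho ε x))
      (rho ε (x + (0:ℝ) • EuclideanSpace.single i (1 : ℝ))) := by simpa using h
  have := HasDerivAt.comp (0:ℝ) h3 h2
  unfold HasLineDerivAt
  refine HasDerivAt.congr_deriv this ?_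
  field_simp

lemma H_line {k ε : ℝ} (hε : 0 < ε) (x : E3) (i : Fin 3) :
    HasLineDerivAt ℝ (fun x => hE k (rho ε x) * x i)
      (hE k (rho ε x) + h2E k (rho ε x) * (x i) ^ 2) x
      (EuclideanSpace.single i (1 : ℝ)) := by
  have hp := rho_pos hε x
  have h := (hE_deriv (k := k) hp)
  have h2 := rho_line hε x i
  have h3 : HasDerivAt (hE k) (rho ε x * h2E k (rho ε x))
      (rho ε (x + (0:ℝ) • EuclideanSpace.single i (1 : ℝ))) := by simpa using h
  have h4 := HasDerivAt.comp (0:ℝ) h3 h2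
  have h5 : HasDerivAt (fun t : ℝ => (x + t • EuclideanSpace.single i (1 : ℝ)) i) 1 0 := by
    simpa using (hasDerivAt_id (0:ℝ)).const_add (x i)
  have := h4.mul h5
  unfold HasLineDerivAt
  refine HasDerivAt.congr_deriv this ?_
  simp
  field_simp
  ring

lemma ibp_i {k ε : ℝ} (hε : 0 < ε) (φ : E3 → ℂ)
    (hφ : ContDiff ℝ (⊤ : ℕ∞) φ) (hsupp : HasCompactSupport φ) (i : Fin 3) :
    ∫ x, gE k (rho ε x) • iteratedFDeriv ℝ 2 φ x
      ![EuclideanSpace.single i 1, EuclideanSpace.single i 1] =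
    ∫ x, (hE k (rho ε x) + h2E k (rho ε x) * (x i) ^ 2) • φ x := by
  set v : E3 := EuclideanSpace.single i (1 : ℝ) with hv
  have c1 : ContDiff ℝ 1 (fun x => fderiv ℝ φ x) := (contDiff_infty.1 hφ 2).fderiv_right (by norm_num)
  have s1 : HasCompactSupport (fun x => fderiv ℝ φ x v) := hsupp.fderiv_apply ℝ v
  have c1' : ContDiff ℝ 1 (fun x => fderiv ℝ φ x v) := c1.clm_apply contDiff_const
  have s2 : HasCompactSupport (fun x => fderiv ℝ (fun x => fderiv ℝ φ x v) x v) :=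
    s1.fderiv_apply ℝ v
  have c2 : Continuous (fun x => fderiv ℝ (fun x => fderiv ℝ φ x v) x v) :=
    (c1'.continuous_fderiv (by simp)).clm_apply continuous_const
  have e : ∀ x, iteratedFDeriv ℝ 2 φ x ![v, v] = fderiv ℝ (fun x => fderiv ℝ φ x v) x v := by
    intro x
    rw [iteratedFDeriv_two_apply, fderiv_clm_apply (c1.differentiable (by simp) x) (by fun_prop)]
    simp
  have gc := gE_cont (k := k) hε
  have hc := hE_cont (k := k) hε
  have h2c := h2E_cont (k := k) hε
  have xc : Continuous (fun x : E3 => x i) := by fun_prop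
  have fc : Continuous φ := hφ.continuous
  simp_rw [e]
  have A := integral_bilinear_hasLineDerivAt_right_eq_neg_left_of_integrable (μ := volume)
    (f := fun x => gE k (rho ε x)) (f' := fun x => hE k (rho ε x) * x i)
    (g := fun x => fderiv ℝ φ x v) (g' := fun x => fderiv ℝ (fun x => fderiv ℝ φ x v) x v)
    (v := v) (B := ContinuousLinearMap.lsmul ℝ ℝ)
    (((hc.mul xc).smul c1'.continuous).integrable_of_hasCompactSupport s1.smul_left)
    ((gc.smul c2).integrable_of_hasCompactSupport s2.smul_left)
    ((gc.smul c1'.continuous).integrable_of_hasCompactSupport s1.smul_left)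
    (fun x _ => G_line hε x i)
    (fun x _ => ((c1'.differentiable (by simp)) x).hasFDerivAt.hasLineDerivAt v)
  have B := integral_bilinear_hasLineDerivAt_right_eq_neg_left_of_integrable (μ := volume)
    (f := fun x => hE k (rho ε x) * x i)
    (f' := fun x => (hE k (rho ε x) + h2E k (rho ε x) * (x i) ^ 2))
    (g := φ) (g' := fun x => fderiv ℝ φ x v)
    (v := v) (B := ContinuousLinearMap.lsmul ℝ ℝ)
    (((hc.add (h2c.mul (xc.pow 2))).smul fc).integrable_of_hasCompactSupport hsupp.smul_left)
    (((hc.mul xc).smul c1'.continuous).integrable_of_hasCompactSupport s1.smul_left)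
    (((hc.mul xc).smul fc).integrable_of_hasCompactSupport hsupp.smul_left)
    (fun x _ => H_line hε x i)
    (fun x _ => ((hφ.differentiable (by simp)) x).hasFDerivAt.hasLineDerivAt v)
  simp only [ContinuousLinearMap.lsmul_apply] at A B
  rw [A, B, neg_neg]

lemma lap_facts (φ : E3 → ℂ) 
    (hφ : ContDiff ℝ (⊤ : ℕ∞) φ) (hsupp : HasCompactSupport φ) (i : Fin 3) :
    Continuous (fun x => iteratedFDeriv ℝ 2 φ x
      ![EuclideanSpace.single i 1, EuclideanSpace.single i 1]) ∧
    HasCompactSupport (fun x => iteratedFDeriv ℝ 2 φ x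
      ![EuclideanSpace.single i 1, EuclideanSpace.single i 1]) := by
  constructor
  · have : Continuous (fun x => iteratedFDeriv ℝ 2 φ x) :=
      (contDiff_infty.1 hφ 2).continuous_iteratedFDeriv (by norm_num)
    fun_prop
  · exact (hsupp.iteratedFDeriv (𝕜 := ℝ) 2).comp_left
      (g := fun f => f ![EuclideanSpace.single i 1, EuclideanSpace.single i 1]) rfl

lemma alg {k ε : ℝ} (hε : 0 < ε) (x : E3) :
    k ^ 2 * gE k (rho ε x) - (∑ i, (hE k (rho ε x) + h2E k (rho ε x) * (x i) ^ 2))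
      = ε ^ 2 * h2E k (rho ε x) := by
  have hp := rho_pos hε x
  have h1 := rho_sq ε x
  rw [EuclideanSpace.real_norm_sq_eq] at h1
  simp only [Fin.sum_univ_three] at *
  have : k ^ 2 * gE k (rho ε x) = 3 * hE k (rho ε x) + h2E k (rho ε x) * rho ε x ^ 2 := by
    unfold gE hE h2E
    field_simp
    ring
  rw [this, h1]
  ring

lemma reg_identity {k ε : ℝ} (hε : 0 < ε) (φ : E3 → ℂ)
    (hφ : ContDiff ℝ (⊤ : ℕ∞) φ) (hsupp : HasCompactSupport φ) :
    ∫ x, gE k (rho ε x) • (-(lap3 φ x) + ((k ^ 2 : ℝ) : ℂ) * φ x) =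
    ∫ x, (ε ^ 2 * h2E k (rho ε x)) • φ x := by
  have gc := gE_cont (k := k) hε
  have hc := hE_cont (k := k) hε
  have h2c := h2E_cont (k := k) hε
  have xc (i) : Continuous (fun x : E3 => x i) := by fun_prop
  have fc : Continuous φ := hφ.continuous
  have I1 : Integrable (fun x => (k ^ 2 * gE k (rho ε x)) • φ x) :=
    ((continuous_const.mul gc).smul fc).integrable_of_hasCompactSupport hsupp.smul_left
  have I2 (i : Fin 3) : Integrable (fun x => gE k (rho ε x) • iteratedFDeriv ℝ 2 φ x
      ![EuclideanSpace.single i 1, EuclideanSpace.single i 1]) :=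
    (gc.smul (lap_facts φ hφ hsupp i).1).integrable_of_hasCompactSupport
      (lap_facts φ hφ hsupp i).2.smul_left
  have I3 (i : Fin 3) : Integrable
      (fun x => (hE k (rho ε x) + h2E k (rho ε x) * (x i) ^ 2) • φ x) :=
    ((hc.add (h2c.mul ((xc i).pow 2))).smul fc).integrable_of_hasCompactSupport hsupp.smul_left
  have L : ∀ x, gE k (rho ε x) • (-(lap3 φ x) + ((k ^ 2 : ℝ) : ℂ) * φ x) =
      (k ^ 2 * gE k (rho ε x)) • φ x - ∑ i : Fin 3, gE k (rho ε x) • iteratedFDeriv ℝ 2 φ x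
      ![EuclideanSpace.single i 1, EuclideanSpace.single i 1] := by
    intro x
    rw [← Finset.smul_sum]
    simp only [lap3, Complex.real_smul]
    push_cast
    ring
  have R : ∀ x, (ε ^ 2 * h2E k (rho ε x)) • φ x = (k ^ 2 * gE k (rho ε x)) • φ x -
      ∑ i : Fin 3, (hE k (rho ε x) + h2E k (rho ε x) * (x i) ^ 2) • φ x := by
    intro x
    rw [← Finset.sum_smul, ← sub_smul, alg hε]
  simp_rw [L, R]
  rw [integral_sub I1 (integrable_finsetSum _ fun i _ => I2 i),
    integral_sub I1 (integrable_finsetSum _ fun i _ => I3 i),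
    integral_finsetSum _ fun i _ => I2 i, integral_finsetSum _ fun i _ => I3 i]
  simp_rw [ibp_i hε φ hφ hsupp]

lemma sigma_int : ∫ y : E3, 3 / (4 * π) / √(1 + ‖y‖ ^ 2) ^ 5 = 1 := by
  rw [integral_fun_norm_addHaar volume (fun r : ℝ => 3 / (4 * π) / √(1 + r ^ 2) ^ 5)]
  have hd : ∀ r ∈ Set.Ici (0:ℝ), HasDerivAt (fun r : ℝ => r ^ 3 / √(1 + r ^ 2) ^ 3 / (4 * π))
      (r ^ (Module.finrank ℝ E3 - 1) • (3 / (4 * π) / √(1 + r ^ 2) ^ 5)) r := by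
    intro r _
    have hp : 0 < 1 + r ^ 2 := by positivity
    have h1 : HasDerivAt (fun r : ℝ => √(1 + r ^ 2)) _ r :=
      ((hasDerivAt_pow 2 r).const_add 1).sqrt hp.ne'
    have h2 := ((hasDerivAt_pow 3 r).div (h1.pow 3) (pow_ne_zero 3 (Real.sqrt_pos.2 hp).ne')).div_const (4 * π)
    refine HasDerivAt.congr_deriv h2 ?_
    have hs : √(1 + r ^ 2) ^ 2 = 1 + r ^ 2 := Real.sq_sqrt hp.le
    have hs0 : 0 < √(1 + r ^ 2) := by positivity
    simp
    generalize √(1 + r ^ 2) = s at *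
    have : r ^ 2 = s ^ 2 - 1 := by linarith
    field_simp
    rw [this]; ring
  have hl : Tendsto (fun r : ℝ => r ^ 3 / √(1 + r ^ 2) ^ 3 / (4 * π)) atTop (𝓝 (1 / (4 * π))) := by
    have h1 : Tendsto (fun r : ℝ => (1 + r ^ 2)⁻¹) atTop (𝓝 0) :=
      tendsto_inv_atTop_zero.comp
        (tendsto_atTop_add_const_left _ _ (tendsto_pow_atTop (by norm_num)))
    have h2 : Tendsto (fun r : ℝ => √(1 - (1 + r ^ 2)⁻¹) ^ 3 / (4 * π)) atTop
        (𝓝 (√(1 - 0) ^ 3 / (4 * π))) :=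
      ((((tendsto_const_nhds.sub h1).sqrt).pow 3).div_const _)
    simp only [sub_zero, Real.sqrt_one, one_pow] at h2
    refine h2.congr' ?_
    filter_upwards [eventually_ge_atTop 0] with r hr
    have : 1 - (1 + r ^ 2)⁻¹ = r ^ 2 / (1 + r ^ 2) := by
      field_simp; ring
    rw [this, Real.sqrt_div (by positivity), Real.sqrt_sq hr, div_pow]
  rw [integral_Ioi_of_hasDerivAt_of_nonneg' hd ?_ hl]
  · have : (volume : Measure E3).real (Metric.ball 0 1) = π * 4 / 3 := by
      rw [Measure.real, EuclideanSpace.volume_ball_fin_three]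
      simp
      positivity
    rw [this]
    simp
    field_simp
  · intro r hr
    simp only [smul_eq_mul]
    have : (0:ℝ) < r := hr
    positivity

lemma inv_norm_int (R : ℝ) : IntegrableOn (fun x : E3 => ‖x‖⁻¹) (Metric.ball 0 R) := by
  rw [integrableOn_fun_norm_addHaar volume (f := fun r : ℝ => r⁻¹)]
  have h : IntegrableOn (fun r : ℝ => r) (Set.Ioo 0 R) :=
    (continuous_id.integrableOn_Icc (a := 0) (b := R)).mono_set Set.Ioo_subset_Icc_self
  refine h.congr_fun ?_ measurableSet_Ioo
  intro r hr
  have := hr.1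
  simp
  field_simp

lemma lhs_lim {k : ℝ} (hk : 0 < k) (ψ : E3 → ℂ) (hψ : Continuous ψ) (hs : HasCompactSupport ψ) :
    Tendsto (fun ε : ℝ => ∫ x, gE k (rho ε x) • ψ x) (𝓝[>] 0) (𝓝 (∫ x, gE k ‖x‖ • ψ x)) := by
  have hne : ∀ᵐ x : E3, x ≠ 0 := compl_mem_ae_iff.2 (measure_singleton 0)
  refine tendsto_integral_filter_of_dominated_convergence (fun x => ‖x‖⁻¹ * ‖ψ x‖) ?_ ?_ ?_ ?_
  · filter_upwards [self_mem_nhdsWithin] with ε hε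
    exact ((gE_cont hε).smul hψ).aestronglyMeasurable
  · filter_upwards [self_mem_nhdsWithin] with ε hε
    filter_upwards [hne] with x hx
    have hε' : 0 < ε := hε
    have hp := rho_pos hε' x
    have hx' : 0 < ‖x‖ := norm_pos_iff.2 hx
    have hle : ‖x‖ ≤ rho ε x := Real.le_sqrt_of_sq_le (by nlinarith)
    rw [norm_smul]
    gcongr
    unfold gE
    rw [Real.norm_of_nonneg (by positivity)]
    have h1 : Real.exp (-k * rho ε x) ≤ 1 := Real.exp_le_one_iff.2 (by nlinarith)
    rw [inv_eq_one_div]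
    have := Real.pi_gt_three
    gcongr
    nlinarith
  · obtain ⟨R, hR⟩ := hs.isBounded.subset_ball (0 : E3)
    obtain ⟨C, hC⟩ := hs.exists_bound_of_continuous hψ
    have h1 : IntegrableOn (fun x : E3 => ‖x‖⁻¹ * ‖ψ x‖) (Metric.ball 0 R) :=
      (inv_norm_int R).mul_bdd (c := C) hψ.norm.aestronglyMeasurable
        (Eventually.of_forall fun x => by simpa using hC x)
    rw [integrableOn_iff_integrable_of_support_subset] at h1
    · exact h1
    · intro x hx
      apply hR
      apply subset_tsupport
      intro h
      apply hx
      simp [h]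
  · filter_upwards [hne] with x hx
    have hx' : 0 < ‖x‖ := norm_pos_iff.2 hx
    refine Tendsto.mono_left ?_ nhdsWithin_le_nhds
    refine Tendsto.smul_const ?_ _
    have : Tendsto (fun ε : ℝ => rho ε x) (𝓝 0) (𝓝 ‖x‖) := by
      have : Continuous (fun ε : ℝ => rho ε x) := by unfold rho; fun_prop
      have := this.tendsto 0
      simpa [rho] using this
    exact (gE_deriv hx').continuousAt.tendsto.comp this

def kE (k ε s : ℝ) : ℝ :=
  (k ^ 2 * ε ^ 2 / s ^ 3 + 3 * k * ε / s ^ 4 + 3 / s ^ 5) * Real.exp (-k * (ε * s)) / (4 * π)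

lemma scale {k ε : ℝ} (hε : 0 < ε) (φ : E3 → ℂ) :
    ∫ x, (ε ^ 2 * h2E k (rho ε x)) • φ x =
    ∫ y, kE k ε (√(1 + ‖y‖ ^ 2)) • φ (ε • y) := by
  have h := Measure.integral_comp_smul (volume : Measure E3)
    (fun x => (ε ^ 2 * h2E k (rho ε x)) • φ x) ε
  have h3 : |(ε ^ Module.finrank ℝ E3)⁻¹| = (ε ^ 3)⁻¹ := by
    rw [abs_of_pos (by positivity)]; simp
  rw [h3] at h
  have h4 : ∫ x, (ε ^ 2 * h2E k (rho ε x)) • φ x = (ε ^ 3) •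
      ∫ x : E3, (ε ^ 2 * h2E k (rho ε (ε • x))) • φ (ε • x) := by
    rw [h, smul_smul, mul_inv_cancel₀ (by positivity), one_smul]
  rw [h4, ← integral_smul]
  congr 1
  ext y
  rw [smul_smul]
  congr 1
  have : rho ε (ε • y) = ε * √(1 + ‖y‖ ^ 2) := by
    unfold rho
    rw [norm_smul, Real.norm_of_nonneg hε.le,
      show (ε * ‖y‖) ^ 2 + ε ^ 2 = ε ^ 2 * (1 + ‖y‖ ^ 2) by ring, Real.sqrt_mul (by positivity),
      Real.sqrt_sq hε.le]
  rw [this]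
  have hp : 0 < √(1 + ‖y‖ ^ 2) := by positivity
  unfold h2E kE
  field_simp

lemma kE_bound {k ε s : ℝ} (hk : 0 < k) (hε : 0 < ε) (hε1 : ε < 1) (hs : 1 ≤ s) :
    ‖kE k ε s‖ ≤ (4 * k + 3) / s ^ 4 := by
  have hs0 : 0 < s := by linarith
  have hpi := Real.pi_gt_three
  unfold kE
  rw [Real.norm_of_nonneg (by positivity)]
  have e1 : Real.exp (-k * (ε * s)) ≤ 1 := Real.exp_le_one_iff.2 (by
    have : 0 < k * (ε * s) := by positivity
    linarith)
  have e2 : (k * ε * s) * Real.exp (-k * (ε * s)) ≤ 1 := by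
    have : k * ε * s ≤ Real.exp (k * ε * s) := by linarith [Real.add_one_le_exp (k * ε * s)]
    rw [show -k * (ε * s) = -(k * ε * s) by ring, Real.exp_neg]
    exact mul_inv_le_one_of_le₀ this (Real.exp_pos _).le
  have e0 := Real.exp_pos (-k * (ε * s))
  set e := Real.exp (-k * (ε * s))
  have : (k ^ 2 * ε ^ 2 / s ^ 3 + 3 * k * ε / s ^ 4 + 3 / s ^ 5) * e / (4 * π) =
     ((k * ε * ((k * ε * s) * e) + 3 * k * ε * e + 3 / s * e) / (4 * π)) / s ^ 4 := by
    field_simp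
  rw [this]
  gcongr
  rw [div_le_iff₀ (by positivity)]
  have a1 : k * ε * ((k * ε * s) * e) ≤ k * 1 * 1 := by gcongr
  have a2 : 3 * k * ε * e ≤ 3 * k * 1 * 1 := by gcongr
  have a3 : 3 / s * e ≤ 3 * 1 := by
    gcongr
    exact div_le_self (by norm_num) hs
  nlinarith

lemma rhs_lim {k : ℝ} (hk : 0 < k) (φ : E3 → ℂ) (hφ : Continuous φ) (hs : HasCompactSupport φ) :
    Tendsto (fun ε : ℝ => ∫ y, kE k ε (√(1 + ‖y‖ ^ 2)) • φ (ε • y)) (𝓝[>] 0) (𝓝 (φ 0)) := by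
  obtain ⟨C, hC⟩ := hs.exists_bound_of_continuous hφ
  have hC0 : 0 ≤ C := (norm_nonneg _).trans (hC 0)
  have key : Tendsto (fun ε : ℝ => ∫ y, kE k ε (√(1 + ‖y‖ ^ 2)) • φ (ε • y)) (𝓝[>] 0)
      (𝓝 (∫ y : E3, (3 / (4 * π) / √(1 + ‖y‖ ^ 2) ^ 5) • φ 0)) := by
    have hp (y : E3) : 0 < √(1 + ‖y‖ ^ 2) := by positivity
    refine tendsto_integral_filter_of_dominated_convergence
      (fun y => ((4 * k + 3) * C) * (1 + ‖y‖ ^ 2) ^ (-(4:ℝ) / 2)) ?_ ?_ ?_ ?_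
    · refine Eventually.of_forall fun ε => Continuous.aestronglyMeasurable ?_
      unfold kE
      fun_prop (disch := intro y; simp [(hp y).ne'])
    · filter_upwards [Ioo_mem_nhdsGT (show (0:ℝ) < 1 by norm_num)] with ε hε
      refine Eventually.of_forall fun y => ?_
      have h1 := kE_bound hk hε.1 hε.2 (s := √(1 + ‖y‖ ^ 2))
        (Real.one_le_sqrt.2 (by nlinarith [sq_nonneg ‖y‖]))
      have h2 : (1 + ‖y‖ ^ 2) ^ (-(4:ℝ) / 2) = 1 / √(1 + ‖y‖ ^ 2) ^ 4 := by
        rw [show -(4:ℝ) / 2 = -((2:ℕ):ℝ) by norm_num, Real.rpow_neg (by positivity),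
          Real.rpow_natCast, show √(1 + ‖y‖ ^ 2) ^ 4 = (√(1 + ‖y‖ ^ 2) ^ 2) ^ 2 by ring,
          Real.sq_sqrt (by positivity), one_div]
      rw [norm_smul, h2]
      calc _ ≤ (4 * k + 3) / √(1 + ‖y‖ ^ 2) ^ 4 * C := by
            gcongr
            exact hC _
        _ = _ := by ring
    · exact (integrable_rpow_neg_one_add_norm_sq (by simp; norm_num)).const_mul _
    · refine Eventually.of_forall fun y => ?_
      refine Tendsto.mono_left ?_ nhdsWithin_le_nhds
      have : Continuous (fun ε : ℝ => kE k ε (√(1 + ‖y‖ ^ 2)) • φ (ε • y)) := by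
        unfold kE; fun_prop
      have := this.tendsto 0
      convert this using 2
      simp [kE]
      left
      have := hp y
      field_simp
  rwa [integral_smul_const, sigma_int, one_smul] at key

/-- `G_λ` is the fundamental solution of `-Δ + λ` in `ℝ³`: for every smooth compactly
supported `φ`, `∫ G_λ (-Δφ + λφ) = φ(0)`, i.e. `(-Δ+λ)G_λ = δ` distributionally. -/
theorem greenFn_fundamental_solution (lam : ℝ) (hlam : 0 < lam)
    (φ : EuclideanSpace ℝ (Fin 3) → ℂ)
    (hφ : ContDiff ℝ (⊤ : ℕ∞) φ) (hsupp : HasCompactSupport φ) :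
    ∫ x, greenFn lam x • (-(lap3 φ x) + (lam : ℂ) * φ x) = φ 0 := by
  have hk : 0 < √lam := Real.sqrt_pos.2 hlam
  have hk2 : √lam ^ 2 = lam := Real.sq_sqrt hlam.le
  have c : Continuous (fun x => -(lap3 φ x) + (lam : ℂ) * φ x) := by
    have h1 : Continuous (lap3 φ) :=
      continuous_finsetSum _ fun i _ => (lap_facts φ hφ hsupp i).1
    have := hφ.continuous
    fun_prop
  have s : HasCompactSupport (fun x => -(lap3 φ x) + (lam : ℂ) * φ x) := by
    have h1 : HasCompactSupport (lap3 φ) := by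
      have h := fun i => (lap_facts φ hφ hsupp i).2
      have := ((h 0).add (h 1)).add (h 2)
      have e : lap3 φ = _ + _ + _ := funext fun x => Fin.sum_univ_three _
      rw [e]
      exact this
    exact (h1.comp_left (g := fun z => -z) neg_zero).add hsupp.mul_left
  have L := lhs_lim hk _ c s
  have R := rhs_lim hk φ hφ.continuous hsupp
  refine tendsto_nhds_unique (L.congr' ?_) R
  filter_upwards [self_mem_nhdsWithin] with ε hε
  rw [← scale hε, ← reg_identity hε φ hφ hsupp, hk2]
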